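/- Let p be an odd positive integer, q a positive integer relatively prime to p, and q* the unique integer with 1 ≤ q* ≤ p−1 and q·q* ≡ 1 (mod p). Let ℓ be an even integer with 0 < ℓ < p. Then δ^τ(p;q,ℓ) = 2·Σ_{i=1}^{ℓ−1} Σ_{j=1}^{q*ℓ−1} (−1)^j·[p ∣ qj − i] + Σ_{j=1}^{q*ℓ−1} (−1)^j·[p ∣ qj − ℓ] + Σ_{j=1}^{q*ℓ−1} (−1)^j·[p ∣ qj] + 1, where [p ∣ a] denotes 1 if p divides a and 0 otherwise. In particular, δ^τ(p;q,ℓ) is given by a signed count of lattice points: interior points of the parallelogram counted with weight 2 and sign (−1)^j, boundary points with weight 1 and sign (−1)^j, plus 1. -/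

import Mathlib

open Finset Real

/-- The modified Casson–Gordon trigonometric sum
`δ^τ(p;q,ℓ) = (2/p) Σ_{k=1}^{p−1} cot(πk/p) · cot(πqk/p + π/2) · sin²(πkℓ/p)`. -/
noncomputable def deltaTau (p q : ℕ) (l : ℤ) : ℝ :=
  (2 / p) * ∑ k ∈ Finset.Icc 1 (p - 1),
    Real.cot (Real.pi * k / p) * Real.cot (Real.pi * q * k / p + Real.pi / 2) *
      (Real.sin (Real.pi * k * l / p)) ^ 2

/-- Trapezoidal sum of `f` over `0, …, n`: the two end terms get weight `1/2`. -/
noncomputable def trapSum (n : ℕ) (f : ℕ → ℂ) : ℂ :=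
  ∑ i ∈ range n, (f i + f (i + 1)) / 2

theorem trapSum_eq_ends_add_sum_Icc (n : ℕ) (hn : 0 < n) (f : ℕ → ℂ) :
    trapSum n f = (f 0 + f n) / 2 + ∑ i ∈ Icc 1 (n - 1), f i := by
  obtain ⟨n, rfl⟩ := Nat.exists_eq_succ_of_ne_zero hn.ne'
  induction n with
  | zero => simp [trapSum]
  | succ n ih =>
    have h := ih n.succ_pos
    unfold trapSum at h ⊢
    rw [sum_range_succ, h]
    simp only [Nat.succ_eq_add_one, Nat.add_sub_cancel]
    rw [Finset.sum_Icc_succ_top (by omega)]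
    ring

theorem sum_trapSum {ι : Type*} (s : Finset ι) (n : ℕ) (f : ι → ℕ → ℂ) :
    ∑ k ∈ s, trapSum n (f k) = trapSum n (fun i => ∑ k ∈ s, f k i) := by
  simp only [trapSum]
  rw [Finset.sum_comm]
  simp only [← Finset.sum_add_distrib, Finset.sum_div]

theorem mul_trapSum (c : ℂ) (n : ℕ) (f : ℕ → ℂ) :
    c * trapSum n f = trapSum n (fun i => c * f i) := by
  simp only [trapSum, Finset.mul_sum]
  exact Finset.sum_congr rfl fun i _ => by ring

theorem trapSum_mul_trapSum (m n : ℕ) (f g : ℕ → ℂ) :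
    trapSum m f * trapSum n g = trapSum m (fun i => trapSum n (fun j => f i * g j)) := by
  rw [mul_comm, mul_trapSum]
  simp only [← mul_trapSum, mul_comm]

theorem two_mul_one_sub_mul_trapSum_pow (n : ℕ) (w : ℂ) :
    2 * (1 - w) * trapSum n (fun i => w ^ i) = (1 + w) * (1 - w ^ n) := by
  rw [← mul_neg_geom_sum w n, trapSum, Finset.mul_sum, Finset.mul_sum, Finset.mul_sum]
  exact Finset.sum_congr rfl fun i _ => by ring

theorem cos_mul_sin_nat_mul (n : ℕ) (x : ℂ) :
    Complex.cos x * Complex.sin (n * x) =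
      Complex.sin x * (Complex.exp (n * x * Complex.I) *
        trapSum n (fun i => Complex.exp (-(2 * x * Complex.I)) ^ i)) := by
  have h := two_mul_one_sub_mul_trapSum_pow n (Complex.exp (-(2 * x * Complex.I)))
  generalize trapSum n (fun i => Complex.exp (-(2 * x * Complex.I)) ^ i) = T at h ⊢
  have e1 : Complex.exp (n * x * Complex.I) = Complex.exp (x * Complex.I) ^ n := by
    rw [← Complex.exp_nat_mul]; ring_nf
  have e2 : Complex.exp (-(2 * x * Complex.I)) = (Complex.exp (x * Complex.I))⁻¹ ^ 2 := by
    rw [← Complex.exp_neg, ← Complex.exp_nat_mul]; push_cast; ring_nf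
  have he := Complex.exp_ne_zero (x * Complex.I)
  simp only [Complex.cos, Complex.sin, neg_mul, Complex.exp_neg (x * Complex.I),
    Complex.exp_neg (n * x * Complex.I), e1]
  rw [e2] at h
  generalize Complex.exp (x * Complex.I) = e at *
  have hn : (e⁻¹ ^ 2) ^ n = (e ^ n)⁻¹ ^ 2 := by
    rw [← pow_mul, mul_comm, pow_mul, inv_pow]
  rw [hn] at h
  have hE : e ^ n ≠ 0 := pow_ne_zero _ he
  generalize e ^ n = E at *
  field_simp at h ⊢
  linear_combination h

theorem neg_sin_mul_sin_nat_mul (n : ℕ) (hn : Even n) (y : ℂ) :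
    -Complex.sin y * Complex.sin (n * y) =
      Complex.cos y * (Complex.exp (-(n * y * Complex.I)) *
        trapSum n (fun j => (-Complex.exp (2 * y * Complex.I)) ^ j)) := by
  have h := two_mul_one_sub_mul_trapSum_pow n (-Complex.exp (2 * y * Complex.I))
  generalize trapSum n (fun j => (-Complex.exp (2 * y * Complex.I)) ^ j) = T at h ⊢
  have e1 : Complex.exp (n * y * Complex.I) = Complex.exp (y * Complex.I) ^ n := by
    rw [← Complex.exp_nat_mul]; ring_nf
  have e2 : Complex.exp (2 * y * Complex.I) = Complex.exp (y * Complex.I) ^ 2 := by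
    rw [← Complex.exp_nat_mul]; push_cast; ring_nf
  have he := Complex.exp_ne_zero (y * Complex.I)
  simp only [Complex.cos, Complex.sin, neg_mul, Complex.exp_neg (y * Complex.I),
    Complex.exp_neg (n * y * Complex.I), e1]
  rw [e2, hn.neg_pow] at h
  generalize Complex.exp (y * Complex.I) = e at *
  have hn : (e ^ 2) ^ n = (e ^ n) ^ 2 := by
    rw [← pow_mul, mul_comm, pow_mul]
  rw [hn] at h
  have hE : e ^ n ≠ 0 := pow_ne_zero _ he
  generalize e ^ n = E at *
  field_simp
  linear_combination - h + (1 - E ^ 2) * (e ^ 2 - 1) * Complex.I_sq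

theorem sum_range_pow_zpow_of_isPrimitiveRoot {p : ℕ} {ω : ℂ} (hω : IsPrimitiveRoot ω p) (a : ℤ) :
    ∑ k ∈ range p, (ω ^ a) ^ k = if (p : ℤ) ∣ a then (p : ℂ) else 0 := by
  split_ifs with h
  · simp [(hω.zpow_eq_one_iff_dvd a).2 h]
  · have h1 : ω ^ a ≠ 1 := fun h' => h ((hω.zpow_eq_one_iff_dvd a).1 h')
    have h2 : (ω ^ a) ^ p = 1 := by
      rw [← zpow_natCast, ← zpow_mul, mul_comm, zpow_mul, zpow_natCast, hω.pow_eq_one, one_zpow]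
    rw [geom_sum_eq h1, h2]
    simp

theorem cos_pi_mul_div_ne_zero_of_odd {p : ℕ} (hodd : Odd p) (n : ℕ) :
    Real.cos (Real.pi * n / p) ≠ 0 := by
  intro h
  obtain ⟨N, hN⟩ := Real.cos_eq_zero_iff.1 h
  have hp0 : (p : ℝ) ≠ 0 := by exact_mod_cast hodd.pos.ne'
  have hpi := Real.pi_ne_zero
  field_simp at hN
  have hN' : (n : ℤ) * 2 = p * (2 * N + 1) := by
    have : (n : ℝ) * 2 = p * (2 * N + 1) := by linear_combination hN
    exact_mod_cast this
  have h1 : Odd ((p : ℤ) * (2 * N + 1)) := ((Int.odd_coe_nat p).2 hodd).mul ⟨N, rfl⟩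
  rw [← hN'] at h1
  exact (Int.not_even_iff_odd.2 h1) ⟨n, by ring⟩

/-- Each summand of `deltaTau` is a product of two trapezoidal geometric sums. -/
theorem cot_mul_cot_mul_sin_sq_eq {p q qstar l k : ℕ} (hodd : Odd p)
    (hinv : (q : ℤ) * (qstar : ℤ) ≡ 1 [ZMOD p]) (hle : Even l) (hk0 : 0 < k) (hkp : k < p) :
    ((Real.cot (Real.pi * k / p) * Real.cot (Real.pi * q * k / p + Real.pi / 2) *
      (Real.sin (Real.pi * k * (l : ℤ) / p)) ^ 2 : ℝ) : ℂ) =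
      trapSum l (fun i => Complex.exp (-(2 * (Real.pi * k / p : ℝ) * Complex.I)) ^ i) *
      trapSum (qstar * l)
        (fun j => (-Complex.exp (2 * (Real.pi * q * k / p : ℝ) * Complex.I)) ^ j) := by
  have hp0 : (p : ℝ) ≠ 0 := by exact_mod_cast hodd.pos.ne'
  have hpR : (0 : ℝ) < p := by exact_mod_cast hodd.pos
  have hsin : Real.sin (Real.pi * k / p) ≠ 0 := by
    refine (Real.sin_pos_of_pos_of_lt_pi (by positivity) ?_).ne'
    rw [div_lt_iff₀ hpR]
    exact mul_lt_mul_of_pos_left (by exact_mod_cast hkp) Real.pi_pos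
  have hcos : Real.cos (Real.pi * q * k / p) ≠ 0 := by
    have := cos_pi_mul_div_ne_zero_of_odd hodd (q * k)
    rwa [Nat.cast_mul, ← mul_assoc] at this
  obtain ⟨c, hc⟩ := hinv.symm.dvd
  obtain ⟨L, hL⟩ := hle
  have hcR : (q : ℝ) * qstar - 1 = p * c := by exact_mod_cast hc
  set x : ℝ := Real.pi * k / p with hx
  set y : ℝ := Real.pi * q * k / p with hy
  have hxy : ((qstar * l : ℕ) : ℝ) * y = l * x + ((c * L * k : ℤ) : ℝ) * (2 * Real.pi) := by
    have hl : (l : ℝ) = L + L := by exact_mod_cast hL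
    rw [hx, hy]
    push_cast
    field_simp
    rw [hl]
    linear_combination (L + L) * hcR
  have hA := cos_mul_sin_nat_mul l x
  have hB := neg_sin_mul_sin_nat_mul (qstar * l) (Even.mul_left ⟨L, hL⟩ _) y
  have hxyC : ((qstar * l : ℕ) : ℂ) * (y : ℂ) =
      l * x + ((c * L * k : ℤ) : ℂ) * (2 * Real.pi) := by exact_mod_cast hxy
  have hexp : Complex.exp (-(((qstar * l : ℕ) : ℂ) * y * Complex.I)) =
      (Complex.exp (l * x * Complex.I))⁻¹ := by
    rw [hxyC, ← Complex.exp_neg, Complex.exp_eq_exp_iff_exists_int]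
    exact ⟨-(c * L * k), by push_cast; ring⟩
  rw [hexp, hxyC, Complex.sin_add_int_mul_two_pi] at hB
  have hE := Complex.exp_ne_zero (l * x * Complex.I)
  have hsC : Complex.sin x ≠ 0 := by exact_mod_cast hsin
  have hcC : Complex.cos y ≠ 0 := by exact_mod_cast hcos
  have hlx : Real.pi * k * (l : ℤ) / p = l * x := by rw [hx]; push_cast; ring
  rw [Real.cot_eq_cos_div_sin, Real.cot_eq_cos_div_sin, Real.cos_add_pi_div_two,
    Real.sin_add_pi_div_two, hlx]
  push_cast
  generalize trapSum l _ = A at *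
  generalize trapSum (qstar * l) _ = B at *
  generalize Complex.exp (l * x * Complex.I) = E at *
  have key : Complex.cos x * Complex.sin (l * x) * (-Complex.sin y * Complex.sin (l * x)) =
      Complex.sin x * Complex.cos y * (A * B) := by
    rw [hA, hB]
    field_simp
  field_simp
  linear_combination key

theorem trapSum_neg_one_pow_of_even {n : ℕ} (hn : Even n) :
    trapSum n (fun j => (-1) ^ j) = 0 := by
  have h := two_mul_one_sub_mul_trapSum_pow n (-1)
  rw [hn.neg_one_pow] at h
  norm_num at h
  exact h

/-- `deltaTau` as a weighted lattice point count over the closed rectangle `[0, l] × [0, q* l]`. -/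
theorem ofReal_deltaTau_eq_trapSum {p q qstar l : ℕ} (hodd : Odd p)
    (hinv : (q : ℤ) * (qstar : ℤ) ≡ 1 [ZMOD p]) (hle : Even l) :
    (deltaTau p q (l : ℤ) : ℂ) =
      2 * trapSum l (fun i => trapSum (qstar * l) (fun j =>
        (-1) ^ j * (if (p : ℤ) ∣ (q : ℤ) * j - i then 1 else 0))) := by
  have hp0 : (p : ℂ) ≠ 0 := by exact_mod_cast hodd.pos.ne'
  have hω := Complex.isPrimitiveRoot_exp p hodd.pos.ne'
  set ω := Complex.exp (2 * Real.pi * Complex.I / p) with hωdef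
  have hsum : ((∑ k ∈ Finset.Icc 1 (p - 1),
      Real.cot (Real.pi * k / p) * Real.cot (Real.pi * q * k / p + Real.pi / 2) *
      (Real.sin (Real.pi * k * (l : ℤ) / p)) ^ 2 : ℝ) : ℂ) =
      ∑ k ∈ range p,
      trapSum l (fun i => Complex.exp (-(2 * (Real.pi * k / p : ℝ) * Complex.I)) ^ i) *
      trapSum (qstar * l)
        (fun j => (-Complex.exp (2 * (Real.pi * q * k / p : ℝ) * Complex.I)) ^ j) := by
    have hr : range p = insert 0 (Icc 1 (p - 1)) := by
      ext a
      have := hodd.pos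
      simp only [mem_range, mem_insert, mem_Icc]
      omega
    rw [hr, sum_insert (by simp), Complex.ofReal_sum]
    simp only [Nat.cast_zero, mul_zero, zero_div, Complex.ofReal_zero, zero_mul, Complex.exp_zero,
      trapSum_neg_one_pow_of_even (hle.mul_left qstar), zero_add]
    refine Finset.sum_congr rfl fun k hk => ?_
    have hk := mem_Icc.1 hk
    exact cot_mul_cot_mul_sin_sq_eq hodd hinv hle (by omega) (by omega)
  have hterm (k i j : ℕ) : Complex.exp (-(2 * (Real.pi * k / p : ℝ) * Complex.I)) ^ i *
      (-Complex.exp (2 * (Real.pi * q * k / p : ℝ) * Complex.I)) ^ j =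
      (-1) ^ j * (ω ^ ((q : ℤ) * j - i)) ^ k := by
    rw [neg_pow, hωdef, ← Complex.exp_nat_mul, ← Complex.exp_nat_mul, ← Complex.exp_int_mul,
      ← Complex.exp_nat_mul, mul_left_comm, ← Complex.exp_add]
    congr 2
    push_cast
    field_simp
    ring
  rw [deltaTau, Complex.ofReal_mul, hsum]
  simp only [trapSum_mul_trapSum, sum_trapSum, hterm, ← Finset.mul_sum,
    sum_range_pow_zpow_of_isPrimitiveRoot hω]
  rw [mul_trapSum, mul_trapSum]
  congr 1
  ext i
  rw [mul_trapSum, mul_trapSum]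
  congr 1
  ext j
  push_cast
  split_ifs
  · field_simp
  · simp

theorem deltaTau_eq_signed_lattice_count (p q : ℕ) (hp : 0 < p) (hq : 0 < q)
    (hodd : Odd p) (hpq : Nat.Coprime p q)
    (qstar : ℕ) (hq1 : 1 ≤ qstar) (hq2 : qstar ≤ p - 1)
    (hinv : (q : ℤ) * (qstar : ℤ) ≡ 1 [ZMOD p])
    (l : ℕ) (hl0 : 0 < l) (hlp : l < p) (hle : Even l) :
    deltaTau p q (l : ℤ) =
      2 * ∑ i ∈ Finset.Icc 1 (l - 1), ∑ j ∈ Finset.Icc 1 (qstar * l - 1),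
          (-1 : ℝ) ^ j * (if (p : ℤ) ∣ ((q : ℤ) * j - i) then 1 else 0)
        + ∑ j ∈ Finset.Icc 1 (qstar * l - 1),
            (-1 : ℝ) ^ j * (if (p : ℤ) ∣ ((q : ℤ) * j - l) then 1 else 0)
        + ∑ j ∈ Finset.Icc 1 (qstar * l - 1),
            (-1 : ℝ) ^ j * (if (p : ℤ) ∣ ((q : ℤ) * j) then 1 else 0)
        + 1 := by
  have hm : 0 < qstar * l := by positivity
  have hreal := ofReal_deltaTau_eq_trapSum (q := q) hodd hinv hle
  have hmod : (p : ℤ) ∣ (q : ℤ) * (qstar * l : ℕ) - l := by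
    have h := hinv.symm.dvd
    have : (q : ℤ) * (qstar * l : ℕ) - l = (q * qstar - 1) * l := by push_cast; ring
    rw [this]
    exact h.mul_right _
  have hsmall (a : ℕ) (ha0 : 0 < a) (hap : a < p) : ¬ (p : ℤ) ∣ a := fun h =>
    absurd (Nat.le_of_dvd ha0 (Int.natCast_dvd_natCast.1 h)) (by omega)
  have hbot (i : ℕ) (hi0 : 0 < i) (hil : i ≤ l) : ¬ (p : ℤ) ∣ (q : ℤ) * (0 : ℕ) - i := by
    intro h
    refine hsmall i hi0 (by omega) ?_
    simpa using h
  have htop (i : ℕ) (hil : i < l) : ¬ (p : ℤ) ∣ (q : ℤ) * (qstar * l : ℕ) - i := by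
    intro h
    refine hsmall (l - i) (by omega) (by omega) ?_
    have := dvd_sub h hmod
    rwa [sub_sub_sub_cancel_left, ← Nat.cast_sub hil.le] at this
  rw [trapSum_eq_ends_add_sum_Icc l hl0] at hreal
  simp only [trapSum_eq_ends_add_sum_Icc _ hm] at hreal
  rw [if_neg (hbot l hl0 le_rfl), if_pos hmod, if_neg (htop 0 hl0),
    (hle.mul_left qstar).neg_one_pow] at hreal
  have hinner : ∀ i ∈ Icc 1 (l - 1),
      (((-1 : ℂ) ^ 0 * (if (p : ℤ) ∣ (q : ℤ) * (0 : ℕ) - i then 1 else 0) +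
        1 * (if (p : ℤ) ∣ (q : ℤ) * (qstar * l : ℕ) - i then 1 else 0)) / 2 +
        ∑ j ∈ Icc 1 (qstar * l - 1),
          (-1 : ℂ) ^ j * (if (p : ℤ) ∣ (q : ℤ) * j - i then 1 else 0)) =
        ∑ j ∈ Icc 1 (qstar * l - 1),
          (-1 : ℂ) ^ j * (if (p : ℤ) ∣ (q : ℤ) * j - i then 1 else 0) := by
    intro i hi
    have hi := mem_Icc.1 hi
    rw [if_neg (hbot i (by omega) (by omega)), if_neg (htop i (by omega))]
    simp
  rw [Finset.sum_congr rfl hinner] at hreal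
  rw [← Complex.ofReal_inj, hreal]
  push_cast
  simp only [apply_ite Complex.ofReal, Complex.ofReal_one, Complex.ofReal_zero, mul_zero,
    sub_zero, dvd_zero, if_true]
  ring
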